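/- The radical of a nonzero symmetric monomial ideal I ⊂ K[x_1,...,x_n] equals the square-free Veronese ideal I_{n,c} where c = ht(I); in particular, the radical of a symmetric monomial ideal is symmetric strongly shifted. -/

import Mathlib

open MvPolynomial

/-- The monomial `x^a` in `K[x_1,...,x_n]`. -/
noncomputable def mon (K : Type) [Field K] (n : ℕ) (a : Fin n → ℕ) :
    MvPolynomial (Fin n) K :=
  monomial (Finsupp.equivFunOnFinite.symm a) 1

/-- A monomial ideal: an ideal generated by monomials. -/
def IsMonomialIdeal (K : Type) [Field K] (n : ℕ)
    (I : Ideal (MvPolynomial (Fin n) K)) : Prop :=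
  ∃ S : Set (Fin n → ℕ), I = Ideal.span (mon K n '' S)

/-- A symmetric (`𝔖_n`-fixed) ideal. -/
def IsSymmetricIdeal (K : Type) [Field K] (n : ℕ)
    (I : Ideal (MvPolynomial (Fin n) K)) : Prop :=
  ∀ σ : Equiv.Perm (Fin n), Ideal.map (rename (σ : Fin n → Fin n)) I = I

/-- The exponent vector obtained from `a` by the Borel move `x^a ↦ x^a · x_i / x_j`. -/
def borelMoveVec (n : ℕ) (a : Fin n → ℕ) (i j : Fin n) : Fin n → ℕ :=
  fun k => if k = i then a k + 1 else if k = j then a k - 1 else a k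

/-- A symmetric strongly shifted ideal (sssi). -/
def IsSSSI (K : Type) [Field K] (n : ℕ)
    (I : Ideal (MvPolynomial (Fin n) K)) : Prop :=
  IsMonomialIdeal K n I ∧ IsSymmetricIdeal K n I ∧
    ∀ lam : Fin n → ℕ, Monotone lam → mon K n lam ∈ I →
      ∀ i j : Fin n, i < j → lam i < lam j →
        mon K n (borelMoveVec n lam i j) ∈ I

/-- The dominance order on partitions: `μ ⊴ λ`. -/
def dominates (n : ℕ) (μ lam : Fin n → ℕ) : Prop :=
  ∀ k : Fin n, ∑ i ∈ Finset.Ici k, μ i ≤ ∑ i ∈ Finset.Ici k, lam i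

/-- The height (codimension) of an ideal: the infimum of the heights of the
prime ideals containing it. -/
noncomputable def idealHeight {R : Type} [CommRing R] (I : Ideal R) : ℕ∞ :=
  ⨅ (P : PrimeSpectrum R) (_ : I ≤ P.asIdeal), Order.height P

namespace MvPolynomial

theorem span_X_image_eq_ker {σ R : Type*} [CommRing R] (s : Set σ) [DecidablePred (· ∈ s)] :
    Ideal.span (X '' s : Set (MvPolynomial σ R)) =
      RingHom.ker (aeval fun i => if i ∈ s then (0 : MvPolynomial σ R) else X i) := by
  apply le_antisymm
  · rw [Ideal.span_le]
    rintro _ ⟨i, hi, rfl⟩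
    simp [RingHom.mem_ker, hi]
  · intro f hf
    set J : Ideal (MvPolynomial σ R) := Ideal.span (X '' s)
    have h : (Ideal.Quotient.mkₐ R J).comp
        (aeval fun i => if i ∈ s then (0 : MvPolynomial σ R) else X i) =
          Ideal.Quotient.mkₐ R J := by
      refine algHom_ext fun i => ?_
      by_cases hi : i ∈ s
      · have hX : (X i : MvPolynomial σ R) ∈ J := Ideal.subset_span ⟨i, hi, rfl⟩
        simpa [hi] using (Ideal.Quotient.eq_zero_iff_mem.mpr hX).symm
      · simp [hi]
    have hf' := AlgHom.congr_fun h f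
    rw [AlgHom.comp_apply, RingHom.mem_ker.mp hf, map_zero] at hf'
    exact Ideal.Quotient.eq_zero_iff_mem.mp hf'.symm

theorem isPrime_span_X_image {σ R : Type*} [CommRing R] [IsDomain R] (s : Set σ) :
    (Ideal.span (X '' s : Set (MvPolynomial σ R))).IsPrime := by
  classical
  rw [span_X_image_eq_ker]
  exact RingHom.ker_isPrime _

theorem card_le_height_span_X_image {σ R : Type*} [CommRing R] [IsDomain R] (s : Finset σ) :
    (s.card : ℕ∞) ≤ (Ideal.span (X '' (s : Set σ) : Set (MvPolynomial σ R))).height := by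
  classical
  induction s using Finset.induction_on with
  | empty => simp
  | insert a s ha ih =>
    have := isPrime_span_X_image (R := R) (s : Set σ)
    have := isPrime_span_X_image (R := R) (insert a s : Set σ)
    rw [Finset.card_insert_of_notMem ha, Nat.cast_add, Nat.cast_one, Finset.coe_insert]
    refine (add_le_add_left ih 1).trans (Ideal.height_add_one_le_of_lt_of_isPrime ?_)
    refine lt_of_le_of_ne
      (Ideal.span_mono (Set.image_mono (Set.subset_insert a (s : Set σ)))) fun h => ?_
    have hX : (X a : MvPolynomial σ R) ∈ Ideal.span (X '' (s : Set σ)) :=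
      h ▸ Ideal.subset_span ⟨a, Set.mem_insert a _, rfl⟩
    obtain ⟨i, hi, hne⟩ := mem_ideal_span_X_image.mp hX (Finsupp.single a 1) (by simp [support_X])
    obtain rfl : a = i := by
      by_contra hai
      simp [hai] at hne
    exact ha hi

theorem height_span_X_image {σ K : Type*} [Finite σ] [Field K] (s : Finset σ) :
    (Ideal.span (X '' (s : Set σ) : Set (MvPolynomial σ K))).height = s.card := by
  classical
  refine le_antisymm ?_ (card_le_height_span_X_image s)
  have := isPrime_span_X_image (R := K) (s : Set σ)
  refine (Ideal.height_le_card_of_mem_minimalPrimes_span_finset (s := s.image X) ?_).trans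
    (by exact_mod_cast Finset.card_image_le)
  rw [Finset.coe_image, Ideal.minimalPrimes_eq_subsingleton_self]
  exact Set.mem_singleton _

end MvPolynomial

section

variable {K : Type} [Field K] {n : ℕ}

theorem idealHeight_eq_height {R : Type} [CommRing R] (I : Ideal R) :
    idealHeight I = I.height := by
  apply le_antisymm
  · rw [Ideal.height_eq_inf_minimalPrimes]
    refine le_iInf₂ fun J hJ => ?_
    have hJp := hJ.isPrime
    exact (iInf₂_le (⟨J, hJp⟩ : PrimeSpectrum R) hJ.1.2).trans_eq
      (PrimeSpectrum.height_eq_orderHeight ⟨J, hJp⟩).symm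
  · exact le_iInf₂ fun P hP =>
      (Ideal.height_mono hP).trans_eq (PrimeSpectrum.height_eq_orderHeight P)

theorem mem_span_mon_iff {A : Set (Fin n → ℕ)} {f : MvPolynomial (Fin n) K} :
    f ∈ Ideal.span (mon K n '' A) ↔ ∀ x ∈ f.support, ∃ a ∈ A, a ≤ ⇑x := by
  have h : mon K n '' A =
      (fun s => monomial s (1 : K)) '' (Finsupp.equivFunOnFinite.symm '' A) := by
    rw [Set.image_image]
    rfl
  rw [h, mem_ideal_span_monomial_image]
  simp only [Set.exists_mem_image]
  rfl

theorem support_mon (a : Fin n → ℕ) :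
    (mon K n a).support = {Finsupp.equivFunOnFinite.symm a} := by
  classical exact support_monomial.trans (if_neg one_ne_zero)

theorem mon_mem_span_mon_iff {A : Set (Fin n → ℕ)} {b : Fin n → ℕ} :
    mon K n b ∈ Ideal.span (mon K n '' A) ↔ ∃ a ∈ A, a ≤ b := by
  simp [mem_span_mon_iff, support_mon]

theorem mon_mem_span_X_image_iff {s : Set (Fin n)} {a : Fin n → ℕ} :
    mon K n a ∈ Ideal.span (X '' s : Set (MvPolynomial (Fin n) K)) ↔ ∃ i ∈ s, a i ≠ 0 := by
  simp [mem_ideal_span_X_image, support_mon]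

theorem mon_mem_of_le {I : Ideal (MvPolynomial (Fin n) K)} {a b : Fin n → ℕ} (hab : a ≤ b)
    (ha : mon K n a ∈ I) : mon K n b ∈ I := by
  refine I.mem_of_dvd ?_ ha
  exact monomial_dvd_monomial.mpr ⟨Or.inr hab, dvd_rfl⟩

theorem mon_zero : mon K n 0 = 1 := by
  rw [mon, show Finsupp.equivFunOnFinite.symm (0 : Fin n → ℕ) = 0 by ext; rfl, one_def]

theorem mon_pow (a : Fin n → ℕ) (k : ℕ) : mon K n a ^ k = mon K n (k • a) := by
  rw [mon, monomial_pow, one_pow, mon]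
  congr 2
  ext
  rfl

theorem rename_mon (σ : Equiv.Perm (Fin n)) (a : Fin n → ℕ) :
    rename σ (mon K n a) = mon K n (a ∘ σ.symm) := by
  rw [mon, rename_monomial, mon]
  congr 2
  ext i
  rw [← σ.apply_symm_apply i, Finsupp.mapDomain_apply σ.injective]
  simp

theorem IsSymmetricIdeal.mon_comp_mem {I : Ideal (MvPolynomial (Fin n) K)}
    (hI : IsSymmetricIdeal K n I) (σ : Equiv.Perm (Fin n)) {a : Fin n → ℕ}
    (ha : mon K n a ∈ I) : mon K n (a ∘ σ) ∈ I := by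
  rw [← hI σ.symm]
  simpa [rename_mon] using Ideal.mem_map_of_mem (rename (σ.symm : Fin n → Fin n)) ha

/-- The set of indices of the variables dividing the monomial `x^a`. -/
def expSupport (a : Fin n → ℕ) : Finset (Fin n) := {i | a i ≠ 0}

@[simp]
theorem mem_expSupport {a : Fin n → ℕ} {i : Fin n} : i ∈ expSupport a ↔ a i ≠ 0 := by
  simp [expSupport]

theorem expSupport_mono {a b : Fin n → ℕ} (hab : a ≤ b) : expSupport a ⊆ expSupport b := by
  intro i hi
  rw [mem_expSupport] at hi ⊢
  have : a i ≤ b i := hab i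
  omega

theorem card_expSupport_eq_sum {a : Fin n → ℕ} (ha : ∀ i, a i ≤ 1) :
    (expSupport a).card = ∑ i, a i := by
  rw [expSupport, Finset.card_filter]
  refine Finset.sum_congr rfl fun i _ => ?_
  have := ha i
  split_ifs <;> omega

theorem exists_perm_expSupport_comp {a b : Fin n → ℕ}
    (h : (expSupport a).card = (expSupport b).card) :
    ∃ σ : Equiv.Perm (Fin n), expSupport (b ∘ σ) = expSupport a := by
  let e := Finset.equivOfCardEq h
  refine ⟨e.extendSubtype, ?_⟩
  ext i
  rw [mem_expSupport, Function.comp_apply, ← mem_expSupport]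
  by_cases hi : i ∈ expSupport a
  · exact iff_of_true (e.extendSubtype_mem i hi) hi
  · exact iff_of_false (e.extendSubtype_not_mem i hi) hi

variable (K n) in
/-- The square-free Veronese ideal generated by all square-free monomials of degree `m`. -/
noncomputable def squarefreeVeronese (m : ℕ) : Ideal (MvPolynomial (Fin n) K) :=
  Ideal.span (mon K n '' {a | (∀ i, a i ≤ 1) ∧ ∑ i, a i = m})

theorem exists_squarefree_le_iff {m : ℕ} {b : Fin n → ℕ} :
    (∃ a ∈ {a : Fin n → ℕ | (∀ i, a i ≤ 1) ∧ ∑ i, a i = m}, a ≤ b) ↔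
      m ≤ (expSupport b).card := by
  constructor
  · rintro ⟨a, ⟨ha, rfl⟩, hab⟩
    rw [← card_expSupport_eq_sum ha]
    exact Finset.card_le_card (expSupport_mono hab)
  · intro hm
    obtain ⟨t, htb, rfl⟩ := Finset.exists_subset_card_eq hm
    refine ⟨fun i => if i ∈ t then 1 else 0, ⟨fun i => by dsimp only; split_ifs <;> simp, by simp⟩, ?_⟩
    intro i
    by_cases hi : i ∈ t
    · simpa [hi, Nat.one_le_iff_ne_zero] using htb hi
    · simp [hi]

theorem mem_squarefreeVeronese_iff {m : ℕ} {f : MvPolynomial (Fin n) K} :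
    f ∈ squarefreeVeronese K n m ↔ ∀ x ∈ f.support, m ≤ (expSupport ⇑x).card := by
  simp only [squarefreeVeronese, mem_span_mon_iff, exists_squarefree_le_iff]

theorem mon_mem_squarefreeVeronese_iff {m : ℕ} {a : Fin n → ℕ} :
    mon K n a ∈ squarefreeVeronese K n m ↔ m ≤ (expSupport a).card := by
  rw [squarefreeVeronese, mon_mem_span_mon_iff, exists_squarefree_le_iff]

theorem card_expSupport_le_borelMoveVec {a : Fin n → ℕ} {i j : Fin n} (h : a i < a j) :
    (expSupport a).card ≤ (expSupport (borelMoveVec n a i j)).card := by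
  have hij : i ≠ j := by
    rintro rfl
    exact h.false
  refine Finset.card_le_card_of_injOn
    (fun k => if k = j ∧ a j = 1 then i else k) ?_ ?_
  · intro k hk
    simp only [Finset.mem_coe, mem_expSupport] at hk ⊢
    unfold borelMoveVec
    grind
  · intro k hk l hl hkl
    simp only [Finset.mem_coe, mem_expSupport] at hk hl
    grind

theorem isSSSI_squarefreeVeronese (m : ℕ) : IsSSSI K n (squarefreeVeronese K n m) := by
  refine ⟨⟨_, rfl⟩, fun σ => ?_, fun a _ ha i j _ h => ?_⟩
  · have hle : ∀ τ : Equiv.Perm (Fin n),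
        Ideal.map (rename (τ : Fin n → Fin n)) (squarefreeVeronese K n m) ≤
          squarefreeVeronese K n m := by
      intro τ
      rw [squarefreeVeronese, Ideal.map_span, Ideal.span_le]
      rintro _ ⟨_, ⟨a, ⟨ha, hm⟩, rfl⟩, rfl⟩
      refine Ideal.subset_span ⟨a ∘ τ.symm, ⟨fun i => ha _, ?_⟩, (rename_mon τ a).symm⟩
      rw [← hm]
      exact Equiv.sum_comp τ.symm a
    refine le_antisymm (hle σ) fun f hf => ?_
    have h := Ideal.mem_map_of_mem (rename (σ : Fin n → Fin n))
      (hle σ.symm (Ideal.mem_map_of_mem (rename (σ.symm : Fin n → Fin n)) hf))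
    simpa [rename_rename] using h
  · rw [mon_mem_squarefreeVeronese_iff] at ha ⊢
    exact ha.trans (card_expSupport_le_borelMoveVec h)

theorem squarefreeVeronese_le_span_X_image {m : ℕ} {s : Finset (Fin n)} (hs : n < m + s.card) :
    squarefreeVeronese K n m ≤ Ideal.span (X '' (s : Set (Fin n))) := by
  rw [squarefreeVeronese, Ideal.span_le]
  rintro _ ⟨a, ⟨ha, hm⟩, rfl⟩
  rw [SetLike.mem_coe, mon_mem_span_X_image_iff]
  rw [← card_expSupport_eq_sum ha] at hm
  have hdisj : ¬ Disjoint (expSupport a) s := by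
    intro hd
    have := (Finset.card_union_of_disjoint hd).symm.trans_le (Finset.card_le_univ _)
    rw [Fintype.card_fin] at this
    omega
  obtain ⟨i, hia, his⟩ := Finset.not_disjoint_iff.mp hdisj
  exact ⟨i, his, mem_expSupport.mp hia⟩

theorem isRadical_squarefreeVeronese (m : ℕ) : (squarefreeVeronese K n m).IsRadical := by
  intro f hf
  rw [mem_squarefreeVeronese_iff]
  intro x hx
  by_contra! hlt
  have hle : squarefreeVeronese K n m ≤
      Ideal.span (X '' (((expSupport ⇑x)ᶜ : Finset (Fin n)) : Set (Fin n))) := by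
    refine squarefreeVeronese_le_span_X_image ?_
    rw [Finset.card_compl, Fintype.card_fin]
    have := Finset.card_le_univ (expSupport ⇑x)
    rw [Fintype.card_fin] at this
    omega
  have hfP := (isPrime_span_X_image _).radical_le_iff.mpr hle hf
  obtain ⟨i, hi, hne⟩ := mem_ideal_span_X_image.mp hfP x hx
  simp [hne] at hi

theorem height_squarefreeVeronese {m : ℕ} (h0 : m ≠ 0) (hm : m ≤ n) :
    (squarefreeVeronese K n m).height = (n - m + 1 : ℕ) := by
  apply le_antisymm
  · obtain ⟨s, -, hs⟩ := Finset.exists_subset_card_eq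
      (show n - m + 1 ≤ (Finset.univ : Finset (Fin n)).card by simp; omega)
    rw [← hs, ← height_span_X_image (K := K)]
    exact Ideal.height_mono (squarefreeVeronese_le_span_X_image (by omega))
  · rw [Ideal.height_eq_inf_minimalPrimes]
    refine le_iInf₂ fun P hP => ?_
    have hPp := hP.isPrime
    classical
    let s : Finset (Fin n) := {i | (X i : MvPolynomial (Fin n) K) ∈ P}
    have hsP : Ideal.span (X '' (s : Set (Fin n))) ≤ P := by
      rw [Ideal.span_le]
      rintro _ ⟨i, hi, rfl⟩
      simpa [s] using hi
    refine le_trans ?_ ((card_le_height_span_X_image s).trans (Ideal.height_mono hsP))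
    rw [Nat.cast_le]
    by_contra! hlt
    have hmem : mon K n (fun i => if i ∈ s then 0 else 1) ∈ P := by
      apply hP.1.2
      rw [mon_mem_squarefreeVeronese_iff]
      have : expSupport (fun i => if i ∈ s then 0 else 1) = sᶜ := by
        ext i
        simp
      rw [this, Finset.card_compl, Fintype.card_fin]
      omega
    rw [mon, monomial_eq, C_1, one_mul, Finsupp.prod, hPp.prod_mem_iff] at hmem
    obtain ⟨i, hi, hiP⟩ := hmem
    have his : i ∈ s := by simpa [s] using hPp.mem_of_pow_mem _ hiP
    simp [his] at hi

theorem exists_radical_eq_squarefreeVeronese {I : Ideal (MvPolynomial (Fin n) K)}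
    (hmono : IsMonomialIdeal K n I) (hsym : IsSymmetricIdeal K n I)
    (hbot : I ≠ ⊥) (htop : I ≠ ⊤) :
    ∃ m : ℕ, m ≠ 0 ∧ m ≤ n ∧ I.radical = squarefreeVeronese K n m := by
  classical
  obtain ⟨S, rfl⟩ := hmono
  have hS : S.Nonempty := by
    rw [Set.nonempty_iff_ne_empty]
    rintro rfl
    simp at hbot
  have hex : ∃ m, ∃ b ∈ S, (expSupport b).card = m := ⟨_, hS.some, hS.some_mem, rfl⟩
  obtain ⟨b, hbS, hb⟩ := Nat.find_spec hex
  have hmin : ∀ a ∈ S, Nat.find hex ≤ (expSupport a).card :=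
    fun a ha => Nat.find_min' hex ⟨a, ha, rfl⟩
  have hbI : mon K n b ∈ Ideal.span (mon K n '' S) := Ideal.subset_span ⟨b, hbS, rfl⟩
  refine ⟨Nat.find hex, fun h0 => htop ?_, ?_, le_antisymm ?_ ?_⟩
  · rw [h0, Finset.card_eq_zero] at hb
    obtain rfl : b = 0 := by
      ext i
      simpa [hb] using mem_expSupport (a := b) (i := i)
    exact (Ideal.eq_top_iff_one _).mpr (by simpa only [mon_zero] using hbI)
  · exact hb.symm.trans_le ((Finset.card_le_univ _).trans_eq (Fintype.card_fin n))
  · rw [(isRadical_squarefreeVeronese _).radical_le_iff, Ideal.span_le]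
    rintro _ ⟨a, ha, rfl⟩
    exact mon_mem_squarefreeVeronese_iff.mpr (hmin a ha)
  · rw [squarefreeVeronese, Ideal.span_le]
    rintro _ ⟨a, ⟨ha, hm⟩, rfl⟩
    rw [← card_expSupport_eq_sum ha] at hm
    obtain ⟨σ, hσ⟩ := exists_perm_expSupport_comp (hm.trans hb.symm)
    refine ⟨∑ i, (b ∘ σ) i, ?_⟩
    rw [mon_pow]
    refine mon_mem_of_le (fun i => ?_) (hsym.mon_comp_mem σ hbI)
    by_cases hi : i ∈ expSupport a
    · have hle := Finset.single_le_sum (f := b ∘ σ) (fun _ _ => Nat.zero_le _)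
        (Finset.mem_univ i)
      exact hle.trans (Nat.le_mul_of_pos_right _ (Nat.pos_of_ne_zero (mem_expSupport.mp hi)))
    · rw [← hσ, mem_expSupport, not_not] at hi
      exact hi.trans_le (Nat.zero_le _)

end

/-- The radical of a nonzero proper symmetric monomial ideal `I` equals the
square-free Veronese ideal `I_{n,c}` (generated by all square-free monomials
of degree `n − c + 1`) where `c = ht(I)`; in particular the radical is
symmetric strongly shifted. -/
theorem radical_of_symmetric (K : Type) [Field K] (n : ℕ)
    (I : Ideal (MvPolynomial (Fin n) K))
    (hmono : IsMonomialIdeal K n I) (hsym : IsSymmetricIdeal K n I)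
    (hbot : I ≠ ⊥) (htop : I ≠ ⊤) :
    ∃ c : ℕ, idealHeight I = (c : ℕ∞) ∧
      I.radical =
        Ideal.span (mon K n '' {a | (∀ i, a i ≤ 1) ∧ ∑ i, a i = n - c + 1}) ∧
      IsSSSI K n I.radical := by
  obtain ⟨m, h0, hm, hrad⟩ := exists_radical_eq_squarefreeVeronese hmono hsym hbot htop
  refine ⟨n - m + 1, ?_, ?_, hrad ▸ isSSSI_squarefreeVeronese m⟩
  · rw [idealHeight_eq_height, ← height_squarefreeVeronese (K := K) h0 hm, ← hrad,
      Ideal.height_eq_inf_minimalPrimes, Ideal.height_eq_inf_minimalPrimes I.radical,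
      Ideal.radical_minimalPrimes]
  · rw [hrad, show n - (n - m + 1) + 1 = m by omega]
    rfl
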